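/- Each generator of the colored eigenvector moment flow is negative semidefinite in L²(π): for every 1 ≤ i < j ≤ N and every function f : {1,…,N}^{2n} → ℝ, one has Σ_{x∈Λⁿ} π(x) f(x) (𝓛_{ij} f)(x) ≤ 0. -/

import Mathlib

open Finset

/-- The number of particles of the configuration `x` at site `i`. -/
def cnt {N n : ℕ} (x : Fin (2 * n) → Fin N) (i : Fin N) : ℕ :=
  (Finset.univ.filter (fun a => x a = i)).card

/-- The move `m^{ij}_{ab}`: if `x_a = x_b = i`, both particles at positions `a, b` jump to
site `j`; otherwise nothing happens. -/
def moveM {N n : ℕ} (i j : Fin N) (a b : Fin (2 * n)) (x : Fin (2 * n) → Fin N) :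
    Fin (2 * n) → Fin N :=
  if x a = i ∧ x b = i then (fun c => if c = a ∨ c = b then j else x c) else x

/-- The exchange move `s^{ij}_{ab}`: if `x_a = i` and `x_b = j`, the two values are
exchanged; otherwise nothing happens. -/
def moveS {N n : ℕ} (i j : Fin N) (a b : Fin (2 * n)) (x : Fin (2 * n) → Fin N) :
    Fin (2 * n) → Fin N :=
  if x a = i ∧ x b = j then (fun c => if c = a then j else if c = b then i else x c) else x

/-- The move part `𝓜_{ij}` of the colored eigenvector moment flow generator. -/
noncomputable def opM {N n : ℕ} (i j : Fin N) (f : (Fin (2 * n) → Fin N) → ℝ)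
    (x : Fin (2 * n) → Fin N) : ℝ :=
  ((cnt x j + 1 : ℝ) / ((cnt x i : ℝ) - 1)) *
      ∑ a : Fin (2 * n), ∑ b ∈ Finset.univ.erase a, (f (moveM i j a b x) - f x) +
    ((cnt x i + 1 : ℝ) / ((cnt x j : ℝ) - 1)) *
      ∑ a : Fin (2 * n), ∑ b ∈ Finset.univ.erase a, (f (moveM j i a b x) - f x)

/-- The exchange part `𝓔_{ij}` of the colored eigenvector moment flow generator. -/
noncomputable def opE {N n : ℕ} (i j : Fin N) (f : (Fin (2 * n) → Fin N) → ℝ)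
    (x : Fin (2 * n) → Fin N) : ℝ :=
  ∑ a : Fin (2 * n), ∑ b ∈ Finset.univ.erase a, (f (moveS i j a b x) - f x)

/-- The generator `𝓛_{ij} = 𝓜_{ij} - 𝓔_{ij}` of the colored eigenvector moment flow. -/
noncomputable def opL {N n : ℕ} (i j : Fin N) (f : (Fin (2 * n) → Fin N) → ℝ)
    (x : Fin (2 * n) → Fin N) : ℝ :=
  opM i j f x - opE i j f x

/-- The reversible measure `π(x) = ∏_i ((n_i(x)-1)!!)²` (with `(-1)!! = 1`). -/
def piMeas {N n : ℕ} (x : Fin (2 * n) → Fin N) : ℕ :=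
  ∏ i : Fin N, (Nat.doubleFactorial (cnt x i - 1)) ^ 2


section helpers
variable {N n : ℕ}

def TT (i j : Fin N) (a : Fin (2 * n)) (x : Fin (2 * n) → Fin N) : Fin (2 * n) → Fin N :=
  Function.update x a (Equiv.swap i j (x a))

noncomputable def ind (i : Fin N) (x : Fin (2 * n) → Fin N) (a : Fin (2 * n)) : ℝ :=
  if x a = i then 1 else 0

noncomputable def cc (x : Fin (2 * n) → Fin N) : ℝ :=
  ∏ k : Fin N, (Nat.doubleFactorial (cnt x k - 1) : ℝ)

def Lam (x : Fin (2 * n) → Fin N) : Prop := ∀ k, Even (cnt x k)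

lemma cc_pos (x : Fin (2 * n) → Fin N) : 0 < cc x := by
  unfold cc
  exact Finset.prod_pos fun k _ => by exact_mod_cast Nat.doubleFactorial_pos _

lemma pi_eq (x : Fin (2 * n) → Fin N) : (piMeas x : ℝ) = cc x * cc x := by
  unfold piMeas cc
  push_cast
  rw [Finset.prod_pow, sq]

lemma cnt_real (x : Fin (2 * n) → Fin N) (i : Fin N) : (cnt x i : ℝ) = ∑ a, ind i x a := by
  simp [cnt, ind]

lemma cnt_update (x : Fin (2 * n) → Fin N) (a : Fin (2 * n)) (v k : Fin N) :
    cnt (Function.update x a v) k + (if x a = k then 1 else 0)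
      = cnt x k + (if v = k then 1 else 0) := by
  have h : ∀ y : Fin (2 * n) → Fin N, cnt y k =
      (if y a = k then 1 else 0) + ∑ b ∈ univ.erase a, (if y b = k then 1 else 0) := by
    intro y
    rw [Finset.add_sum_erase _ (fun b => if y b = k then 1 else 0) (mem_univ a)]
    simp [cnt]
  rw [h (Function.update x a v), h x]
  have : ∑ b ∈ univ.erase a, (if Function.update x a v b = k then 1 else 0)
      = ∑ b ∈ univ.erase a, (if x b = k then 1 else 0) := by
    apply Finset.sum_congr rfl
    intro b hb
    rw [Function.update_of_ne (Finset.ne_of_mem_erase hb)]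
  rw [this]
  simp
  ring

lemma TT_invol (i j : Fin N) (a : Fin (2 * n)) (x : Fin (2 * n) → Fin N) :
    TT i j a (TT i j a x) = x := by
  simp [TT]

lemma TT_ne (i j : Fin N) {a b : Fin (2 * n)} (h : b ≠ a) (x : Fin (2 * n) → Fin N) :
    TT i j a x b = x b := by
  simp [TT, h]

lemma TT_comm (i j : Fin N) (a b : Fin (2 * n)) (x : Fin (2 * n) → Fin N) :
    TT i j a (TT i j b x) = TT i j b (TT i j a x) := by
  by_cases h : a = b
  · rw [h]
  · simp [TT, h, Ne.symm h, Function.update_comm (Ne.symm h)]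

lemma TT_symm (i j : Fin N) (a : Fin (2 * n)) (x : Fin (2 * n) → Fin N) :
    TT j i a x = TT i j a x := by
  simp [TT, Equiv.swap_comm]

lemma ind_TT_self {i j : Fin N} (a : Fin (2 * n)) (x : Fin (2 * n) → Fin N) :
    ind i (TT i j a x) a = ind j x a := by
  simp only [ind, TT, Function.update_self]
  congr 1
  rw [Equiv.swap_apply_eq_iff, Equiv.swap_apply_left]

lemma ind_TT_self' {i j : Fin N} (a : Fin (2 * n)) (x : Fin (2 * n) → Fin N) :
    ind j (TT i j a x) a = ind i x a := by
  rw [← TT_symm, ind_TT_self]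

lemma ind_TT_ne (k i j : Fin N) {a b : Fin (2 * n)} (h : b ≠ a) (x : Fin (2 * n) → Fin N) :
    ind k (TT i j a x) b = ind k x b := by
  simp [ind, TT_ne i j h]

lemma moveM_eq (i j : Fin N) {a b : Fin (2 * n)} (h : b ≠ a) (x : Fin (2 * n) → Fin N)
    (f : (Fin (2 * n) → Fin N) → ℝ) :
    f (moveM i j a b x) - f x = ind i x a * ind i x b * (f (TT i j a (TT i j b x)) - f x) := by
  unfold moveM
  by_cases h1 : x a = i
  · by_cases h2 : x b = i
    · have : (fun c => if c = a ∨ c = b then j else x c) = TT i j a (TT i j b x) := by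
        ext c
        by_cases ha : c = a
        · subst ha; simp [TT, h1, h2, Ne.symm h]
        · by_cases hb : c = b
          · subst hb; simp [TT, h1, h2, h]
          · simp [TT, ha, hb]
      simp [h1, h2, ind, this]
    · simp [h1, h2, ind]
  · simp [h1, ind]

lemma moveS_eq (i j : Fin N) {a b : Fin (2 * n)} (h : b ≠ a) (x : Fin (2 * n) → Fin N)
    (f : (Fin (2 * n) → Fin N) → ℝ) :
    f (moveS i j a b x) - f x = ind i x a * ind j x b * (f (TT i j a (TT i j b x)) - f x) := by
  unfold moveS
  by_cases h1 : x a = i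
  · by_cases h2 : x b = j
    · have : (fun c => if c = a then j else if c = b then i else x c)
          = TT i j a (TT i j b x) := by
        ext c
        by_cases ha : c = a
        · subst ha; simp [TT, h1, h2, Ne.symm h]
        · by_cases hb : c = b
          · subst hb; simp [TT, h1, h2, h]
          · simp [TT, ha, hb]
      simp [h1, h2, ind, this]
    · simp [h1, h2, ind]
  · simp [h1, ind]

lemma cnt_same {i j : Fin N} (hij : i ≠ j) {a b : Fin (2 * n)} (h : b ≠ a)
    (x : Fin (2 * n) → Fin N) (ha : x a = i) (hb : x b = i) (k : Fin N) :
    cnt (TT i j a (TT i j b x)) k + (if i = k then 2 else 0)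
      = cnt x k + (if j = k then 2 else 0) := by
  have h1 := cnt_update x b (Equiv.swap i j (x b)) k
  have h2 := cnt_update (TT i j b x) a (Equiv.swap i j (TT i j b x a)) k
  rw [TT_ne i j (Ne.symm h)] at h2
  simp only [ha, hb, Equiv.swap_apply_left] at h1 h2
  have e1 : Function.update x b j = TT i j b x := by simp [TT, hb]
  have e2 : Function.update (TT i j b x) a j = TT i j a (TT i j b x) := by
    rw [show TT i j a (TT i j b x) = Function.update (TT i j b x) a
      (Equiv.swap i j (TT i j b x a)) from rfl, TT_ne i j (Ne.symm h)]
    simp [ha]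
  rw [e1] at h1
  rw [e2] at h2
  split_ifs at * <;> omega

lemma cnt_opp {i j : Fin N} (hij : i ≠ j) {a b : Fin (2 * n)} (h : b ≠ a)
    (x : Fin (2 * n) → Fin N) (ha : x a = i) (hb : x b = j) (k : Fin N) :
    cnt (TT i j a (TT i j b x)) k = cnt x k := by
  have h1 := cnt_update x b (Equiv.swap i j (x b)) k
  have h2 := cnt_update (TT i j b x) a (Equiv.swap i j (TT i j b x a)) k
  rw [TT_ne i j (Ne.symm h)] at h2
  simp only [ha, hb, Equiv.swap_apply_left, Equiv.swap_apply_right] at h1 h2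
  have e1 : Function.update x b i = TT i j b x := by simp [TT, hb]
  have e2 : Function.update (TT i j b x) a j = TT i j a (TT i j b x) := by
    rw [show TT i j a (TT i j b x) = Function.update (TT i j b x) a
      (Equiv.swap i j (TT i j b x a)) from rfl, TT_ne i j (Ne.symm h)]
    simp [ha]
  rw [e1] at h1
  rw [e2] at h2
  split_ifs at * <;> omega

lemma cc_opp {i j : Fin N} (hij : i ≠ j) {a b : Fin (2 * n)} (h : b ≠ a)
    (x : Fin (2 * n) → Fin N) (ha : x a = i) (hb : x b = j) :
    cc (TT i j a (TT i j b x)) = cc x := by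
  unfold cc
  simp only [cnt_opp hij h x ha hb]

lemma Lam_opp {i j : Fin N} (hij : i ≠ j) {a b : Fin (2 * n)} (h : b ≠ a)
    (x : Fin (2 * n) → Fin N) (ha : x a = i) (hb : x b = j) :
    Lam (TT i j a (TT i j b x)) ↔ Lam x := by
  unfold Lam
  simp only [cnt_opp hij h x ha hb]

lemma Lam_same {i j : Fin N} (hij : i ≠ j) {a b : Fin (2 * n)} (h : b ≠ a)
    (x : Fin (2 * n) → Fin N) (ha : x a = i) (hb : x b = i) :
    Lam (TT i j a (TT i j b x)) ↔ Lam x := by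
  unfold Lam
  refine forall_congr' fun k => ?_
  have := cnt_same hij h x ha hb k
  rw [Nat.even_iff, Nat.even_iff]
  split_ifs at this <;> omega

lemma cc_same {i j : Fin N} (hij : i ≠ j) {a b : Fin (2 * n)} (h : b ≠ a)
    (x : Fin (2 * n) → Fin N) (ha : x a = i) (hb : x b = i) (hx : Lam x) :
    cc (TT i j a (TT i j b x)) * ((cnt x i : ℝ) - 1) = cc x * (cnt x j + 1) := by
  have hc := cnt_same hij h x ha hb
  set y := TT i j a (TT i j b x) with hy
  have hs : ∀ z : Fin (2 * n) → Fin N, cc z = (Nat.doubleFactorial (cnt z i - 1) : ℝ) *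
      ((Nat.doubleFactorial (cnt z j - 1) : ℝ) *
        ∏ k ∈ (univ.erase i).erase j, (Nat.doubleFactorial (cnt z k - 1) : ℝ)) := by
    intro z
    unfold cc
    rw [Finset.mul_prod_erase (univ.erase i)
      (fun k => (Nat.doubleFactorial (cnt z k - 1) : ℝ)) (by simp [hij.symm]),
      Finset.mul_prod_erase univ
      (fun k => (Nat.doubleFactorial (cnt z k - 1) : ℝ)) (by simp)]
  have hp : ∏ k ∈ (univ.erase i).erase j, (Nat.doubleFactorial (cnt y k - 1) : ℝ)
      = ∏ k ∈ (univ.erase i).erase j, (Nat.doubleFactorial (cnt x k - 1) : ℝ) := by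
    apply Finset.prod_congr rfl
    intro k hk
    simp only [mem_erase, mem_univ, and_true] at hk
    have := hc k
    simp only [Ne.symm hk.1, Ne.symm hk.2, if_false] at this
    rw [show cnt y k = cnt x k by omega]
  have hi := hc i
  have hj := hc j
  simp only [if_true, hij, hij.symm, if_false, add_zero] at hi hj
  rw [hs y, hs x, hp, hj, ← hi]
  have d1 : ∀ m, Nat.doubleFactorial (m + 2 - 1) = (m + 1) * Nat.doubleFactorial (m - 1) := by
    intro m
    cases m with
    | zero => simp
    | succ m => rw [show m + 1 + 2 - 1 = m + 2 by omega, Nat.doubleFactorial_add_two]; rfl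
  rw [d1, d1]
  push_cast
  ring

noncomputable def gg (f : (Fin (2 * n) → Fin N) → ℝ) (x : Fin (2 * n) → Fin N) : ℝ :=
  open Classical in if Lam x then cc x * f x else 0

noncomputable def hh (i j : Fin N) (a : Fin (2 * n)) (g : (Fin (2 * n) → Fin N) → ℝ)
    (x : Fin (2 * n) → Fin N) : ℝ := (ind i x a - ind j x a) * g (TT i j a x)

lemma sum_TT (i j : Fin N) (a : Fin (2 * n)) (F : (Fin (2 * n) → Fin N) → ℝ) :
    ∑ x, F (TT i j a x) = ∑ x, F x :=
  Equiv.sum_comp (Function.Involutive.toPerm (TT i j a) (TT_invol i j a)) F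

lemma hh_anti (i j : Fin N) (a : Fin (2 * n)) (g g' : (Fin (2 * n) → Fin N) → ℝ) :
    ∑ x, g x * hh i j a g' x = - ∑ x, hh i j a g x * g' x := by
  rw [← sum_TT i j a, ← Finset.sum_neg_distrib]
  apply Finset.sum_congr rfl
  intro x _
  simp only [hh, TT_invol, ind_TT_self, ind_TT_self']
  ring

lemma XX_nonpos (i j : Fin N) (g : (Fin (2 * n) → Fin N) → ℝ) :
    ∑ x, g x * ∑ a, ∑ b, hh i j a (hh i j b g) x ≤ 0 := by
  have : ∑ x, g x * ∑ a, ∑ b, hh i j a (hh i j b g) x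
      = - ∑ x, (∑ a, hh i j a g x) ^ 2 := by
    calc _ = ∑ a, ∑ b, ∑ x, g x * hh i j a (hh i j b g) x := by
          simp only [Finset.mul_sum]
          rw [Finset.sum_comm]
          refine Finset.sum_congr rfl fun a _ => ?_
          rw [Finset.sum_comm]
      _ = ∑ a, ∑ b, - ∑ x, hh i j a g x * hh i j b g x := by
          simp only [hh_anti i j _ g]
      _ = _ := by
          simp only [Finset.sum_neg_distrib, sq, Finset.sum_mul_sum]
          congr 1
          symm
          rw [Finset.sum_comm]
          refine Finset.sum_congr rfl fun a _ => ?_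
          rw [Finset.sum_comm]
  rw [this]
  have : 0 ≤ ∑ x, (∑ a, hh i j a g x) ^ 2 := Finset.sum_nonneg fun x _ => sq_nonneg _
  linarith

/-- same-colour indicator -/
noncomputable def sm (i j : Fin N) (x : Fin (2 * n) → Fin N) (a b : Fin (2 * n)) : ℝ :=
  ind i x a * ind i x b + ind j x a * ind j x b

noncomputable def op (i j : Fin N) (x : Fin (2 * n) → Fin N) (a b : Fin (2 * n)) : ℝ :=
  ind i x a * ind j x b + ind j x a * ind i x b

lemma rate {i j : Fin N} (hij : i ≠ j) {a b : Fin (2 * n)} (h : b ≠ a)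
    (x : Fin (2 * n) → Fin N) (hx : Lam x) :
    ind i x a * ind i x b * cc (TT i j a (TT i j b x))
      = ind i x a * ind i x b * (cc x * ((cnt x j + 1 : ℝ) / ((cnt x i : ℝ) - 1))) := by
  by_cases ha : x a = i
  · by_cases hb : x b = i
    · have h0 : (cnt x i : ℝ) - 1 ≠ 0 := by
        intro h0
        have : cnt x i = 1 := by
          have : (cnt x i : ℝ) = 1 := by linarith
          exact_mod_cast this
        have h2 := hx i
        rw [this] at h2
        exact absurd h2 (by decide)
      have := cc_same hij h x ha hb hx
      rw [← mul_div_assoc, ← this]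
      field_simp
    · simp [ind, hb]
  · simp [ind, ha]

lemma rate' {i j : Fin N} (hij : i ≠ j) {a b : Fin (2 * n)} (h : b ≠ a)
    (x : Fin (2 * n) → Fin N) (hx : Lam x) :
    ind j x a * ind j x b * cc (TT i j a (TT i j b x))
      = ind j x a * ind j x b * (cc x * ((cnt x i + 1 : ℝ) / ((cnt x j : ℝ) - 1))) := by
  have := rate hij.symm h x hx
  rwa [TT_symm i j a, TT_symm i j b] at this

lemma opM_eq {i j : Fin N} (hij : i ≠ j) (f : (Fin (2 * n) → Fin N) → ℝ)
    (x : Fin (2 * n) → Fin N) (hx : Lam x) :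
    cc x * opM i j f x = ∑ a, ∑ b ∈ univ.erase a,
      sm i j x a b * cc (TT i j a (TT i j b x)) * (f (TT i j a (TT i j b x)) - f x) := by
  unfold opM
  rw [mul_add, ← mul_assoc, ← mul_assoc]
  simp only [Finset.mul_sum]
  rw [← Finset.sum_add_distrib]
  refine Finset.sum_congr rfl fun a _ => ?_
  rw [← Finset.sum_add_distrib]
  refine Finset.sum_congr rfl fun b hb => ?_
  have h := Finset.ne_of_mem_erase hb
  rw [moveM_eq i j h, moveM_eq j i h, TT_symm i j a, TT_symm i j b, sm, add_mul, rate hij h x hx,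
    rate' hij h x hx]
  ring

lemma sum_swap (F : Fin (2 * n) → Fin (2 * n) → ℝ) :
    ∑ a, ∑ b ∈ univ.erase a, F a b = ∑ a, ∑ b ∈ univ.erase a, F b a := by
  rw [Finset.sum_comm']
  intro a b
  simp [eq_comm]

lemma opp_cc {i j : Fin N} (hij : i ≠ j) {a b : Fin (2 * n)} (h : b ≠ a)
    (x : Fin (2 * n) → Fin N) :
    op i j x a b * cc (TT i j a (TT i j b x)) = op i j x a b * cc x := by
  by_cases h1 : x a = i ∧ x b = j
  · rw [cc_opp hij h x h1.1 h1.2]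
  · by_cases h2 : x a = j ∧ x b = i
    · rw [TT_comm, cc_opp hij h.symm x h2.2 h2.1]
    · have : op i j x a b = 0 := by
        unfold op ind
        split_ifs <;> simp_all
      simp [this]

lemma opE_eq {i j : Fin N} (hij : i ≠ j) (f : (Fin (2 * n) → Fin N) → ℝ)
    (x : Fin (2 * n) → Fin N) :
    cc x * (2 * opE i j f x) = ∑ a, ∑ b ∈ univ.erase a,
      op i j x a b * cc (TT i j a (TT i j b x)) * (f (TT i j a (TT i j b x)) - f x) := by
  have h1 : opE i j f x = ∑ a, ∑ b ∈ univ.erase a,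
      ind i x a * ind j x b * (f (TT i j a (TT i j b x)) - f x) := by
    unfold opE
    refine Finset.sum_congr rfl fun a _ => Finset.sum_congr rfl fun b hb => ?_
    exact moveS_eq i j (Finset.ne_of_mem_erase hb) x f
  have h2 := h1
  rw [sum_swap] at h2
  rw [two_mul]
  nth_rewrite 1 [h1]
  rw [h2, ← Finset.sum_add_distrib, Finset.mul_sum]
  refine Finset.sum_congr rfl fun a _ => ?_
  rw [← Finset.sum_add_distrib, Finset.mul_sum]
  refine Finset.sum_congr rfl fun b hb => ?_
  rw [opp_cc hij (Finset.ne_of_mem_erase hb), TT_comm i j b a, op]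
  ring

lemma gg_T {i j : Fin N} (hij : i ≠ j) (f : (Fin (2 * n) → Fin N) → ℝ)
    {a b : Fin (2 * n)} (h : b ≠ a) (x : Fin (2 * n) → Fin N) (hx : Lam x) :
    (sm i j x a b - op i j x a b) * gg f (TT i j a (TT i j b x))
     = (sm i j x a b - op i j x a b) * (cc (TT i j a (TT i j b x)) * f (TT i j a (TT i j b x))) := by
  by_cases hL : Lam (TT i j a (TT i j b x))
  · simp [gg, hL]
  · have : sm i j x a b - op i j x a b = 0 := by
      have h1 : ¬ (x a = i ∧ x b = j) := fun h1 => hL ((Lam_opp hij h x h1.1 h1.2).2 hx)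
      have h2 : ¬ (x a = j ∧ x b = i) := fun h1 => hL (by
        rw [TT_comm]; exact (Lam_opp hij h.symm x h1.2 h1.1).2 hx)
      have h3 : ¬ (x a = i ∧ x b = i) := fun h1 => hL ((Lam_same hij h x h1.1 h1.2).2 hx)
      have h4 : ¬ (x a = j ∧ x b = j) := fun h1 => hL (by
        rw [← TT_symm, ← TT_symm i j b]; exact (Lam_same hij.symm h x h1.1 h1.2).2 hx)
      unfold sm op ind
      split_ifs <;> simp_all
    simp [this]

lemma ind_mul {i j : Fin N} (hij : i ≠ j) (x : Fin (2 * n) → Fin N) (a : Fin (2 * n)) :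
    ind i x a * ind j x a = 0 := by
  unfold ind
  split_ifs <;> simp_all

lemma ind_sq (i : Fin N) (x : Fin (2 * n) → Fin N) (a : Fin (2 * n)) :
    ind i x a * ind i x a = ind i x a := by
  unfold ind
  split_ifs <;> simp_all

lemma XX_eq {i j : Fin N} (hij : i ≠ j) (f : (Fin (2 * n) → Fin N) → ℝ)
    (x : Fin (2 * n) → Fin N) (hx : Lam x) :
    ∑ a, ∑ b, hh i j a (hh i j b (gg f)) x =
     ∑ a, ∑ b ∈ univ.erase a, (sm i j x a b - op i j x a b) *
       (cc (TT i j a (TT i j b x)) * f (TT i j a (TT i j b x)))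
     - (cnt x i + cnt x j) * (cc x * f x) := by
  rw [cnt_real, cnt_real, ← Finset.sum_add_distrib, Finset.sum_mul, ← Finset.sum_sub_distrib]
  refine Finset.sum_congr rfl fun a _ => ?_
  rw [← Finset.add_sum_erase _ _ (mem_univ a), add_comm, sub_eq_add_neg]
  congr 1
  · refine Finset.sum_congr rfl fun b hb => ?_
    have h := Finset.ne_of_mem_erase hb
    rw [← gg_T hij f h x hx]
    simp only [hh, ind_TT_ne _ _ _ h, TT_comm i j b a, sm, op]
    ring
  · simp only [hh, TT_invol, ind_TT_self, ind_TT_self', gg, hx, if_true]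
    linear_combination (-(cc x * f x)) * (ind_sq i x a + ind_sq j x a - 2 * ind_mul hij x a)

lemma sum_erase_mul (u v : Fin (2 * n) → ℝ) :
    ∑ a, ∑ b ∈ univ.erase a, u a * v b = (∑ a, u a) * (∑ b, v b) - ∑ a, u a * v a := by
  rw [Finset.sum_mul_sum, ← Finset.sum_sub_distrib]
  refine Finset.sum_congr rfl fun a _ => ?_
  rw [← Finset.add_sum_erase _ _ (mem_univ a)]
  ring

lemma Lam_ne {x : Fin (2 * n) → Fin N} (hx : Lam x) (i : Fin N) : (cnt x i : ℝ) - 1 ≠ 0 := by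
  intro h0
  have : cnt x i = 1 := by
    have : (cnt x i : ℝ) = 1 := by linarith
    exact_mod_cast this
  have h2 := hx i
  rw [this] at h2
  exact absurd h2 (by decide)

lemma count_eq {i j : Fin N} (hij : i ≠ j)
    (x : Fin (2 * n) → Fin N) (hx : Lam x) :
    ∑ a, ∑ b ∈ univ.erase a, (sm i j x a b - op i j x a b) * cc (TT i j a (TT i j b x))
      = (cnt x i + cnt x j) * cc x := by
  have h1 : ∀ a, ∀ b ∈ univ.erase a,
      (sm i j x a b - op i j x a b) * cc (TT i j a (TT i j b x)) =
      (cc x * ((cnt x j + 1 : ℝ) / ((cnt x i : ℝ) - 1))) * (ind i x a * ind i x b)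
      + (cc x * ((cnt x i + 1 : ℝ) / ((cnt x j : ℝ) - 1))) * (ind j x a * ind j x b)
      - cc x * (ind i x a * ind j x b) - cc x * (ind j x a * ind i x b) := by
    intro a b hb
    have h := Finset.ne_of_mem_erase hb
    rw [sub_mul, opp_cc hij h, sm, add_mul, rate hij h x hx, rate' hij h x hx, op]
    ring
  rw [Finset.sum_congr rfl fun a _ => Finset.sum_congr rfl (h1 a)]
  simp only [Finset.sum_sub_distrib, Finset.sum_add_distrib, ← Finset.mul_sum]
  simp only [Finset.mul_sum (univ.erase _), sum_erase_mul, ind_sq, ind_mul hij, ind_mul hij.symm, ← cnt_real]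
  have := Lam_ne hx i
  have := Lam_ne hx j
  simp only [Finset.sum_const_zero]
  field_simp
  ring

lemma key {i j : Fin N} (hij : i ≠ j) (f : (Fin (2 * n) → Fin N) → ℝ)
    (x : Fin (2 * n) → Fin N) (hx : Lam x) :
    cc x * (opM i j f x - 2 * opE i j f x) = ∑ a, ∑ b, hh i j a (hh i j b (gg f)) x := by
  rw [XX_eq hij f x hx, mul_sub, opM_eq hij f x hx, opE_eq hij,
    show ((cnt x i : ℝ) + cnt x j) * (cc x * f x) = ((cnt x i + cnt x j) * cc x) * f x by ring,
    ← count_eq hij x hx, Finset.sum_mul, ← Finset.sum_sub_distrib, ← Finset.sum_sub_distrib]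
  refine Finset.sum_congr rfl fun a _ => ?_
  rw [Finset.sum_mul, ← Finset.sum_sub_distrib, ← Finset.sum_sub_distrib]
  refine Finset.sum_congr rfl fun b _ => ?_
  ring

lemma gg_of {f : (Fin (2 * n) → Fin N) → ℝ} {x : Fin (2 * n) → Fin N} (hx : Lam x) :
    gg f x = cc x * f x := by simp [gg, hx]

lemma part2 {i j : Fin N} (hij : i ≠ j) (f : (Fin (2 * n) → Fin N) → ℝ) :
    ∑ x ∈ Finset.univ.filter (fun x : Fin (2 * n) → Fin N => ∀ k, Even (cnt x k)),
      (piMeas x : ℝ) * f x * (opM i j f x - 2 * opE i j f x) ≤ 0 := by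
  refine le_trans (le_of_eq ?_) (XX_nonpos i j (gg f))
  rw [Finset.sum_filter]
  refine Finset.sum_congr rfl fun x _ => ?_
  split_ifs with hx
  · rw [gg_of hx, ← key hij f x hx, pi_eq]; ring
  · have : gg f x = 0 := by
      unfold gg
      exact if_neg hx
    rw [this, zero_mul]

noncomputable def lam (x : Fin (2 * n) → Fin N) : ℝ :=
  open Classical in if Lam x then 1 else 0

lemma lam_congr {x y : Fin (2 * n) → Fin N} (h : Lam x ↔ Lam y) : lam x = lam y := by
  unfold lam
  by_cases hx : Lam x
  · rw [if_pos hx, if_pos (h.1 hx)]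
  · rw [if_neg hx, if_neg (fun hy => hx (h.2 hy))]

lemma lam_nonneg (x : Fin (2 * n) → Fin N) : 0 ≤ lam x := by
  unfold lam
  split_ifs <;> norm_num

lemma sm_lam {i j : Fin N} (hij : i ≠ j) {a b : Fin (2 * n)} (h : b ≠ a)
    (x : Fin (2 * n) → Fin N) :
    sm i j x a b * lam (TT i j a (TT i j b x)) = sm i j x a b * lam x := by
  by_cases h1 : x a = i ∧ x b = i
  · rw [lam_congr (Lam_same hij h x h1.1 h1.2)]
  · by_cases h2 : x a = j ∧ x b = j
    · have := Lam_same hij.symm h x h2.1 h2.2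
      rw [TT_symm i j a, TT_symm i j b] at this
      rw [lam_congr this]
    · have : sm i j x a b = 0 := by
        unfold sm ind
        split_ifs <;> simp_all
      simp [this]

lemma sm_nonneg (i j : Fin N) (a b : Fin (2 * n)) (x : Fin (2 * n) → Fin N) :
    0 ≤ sm i j x a b := by
  unfold sm ind
  split_ifs <;> norm_num

lemma part1 {i j : Fin N} (hij : i ≠ j) (f : (Fin (2 * n) → Fin N) → ℝ) :
    ∑ x ∈ Finset.univ.filter (fun x : Fin (2 * n) → Fin N => ∀ k, Even (cnt x k)),
      (piMeas x : ℝ) * f x * opM i j f x ≤ 0 := by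
  have e : ∑ x ∈ Finset.univ.filter (fun x : Fin (2 * n) → Fin N => ∀ k, Even (cnt x k)),
      (piMeas x : ℝ) * f x * opM i j f x = ∑ a, ∑ b ∈ univ.erase a, ∑ x,
        sm i j x a b * lam x * cc x * cc (TT i j a (TT i j b x)) *
          (f x * (f (TT i j a (TT i j b x)) - f x)) := by
    have : ∀ a : Fin (2 * n), ∑ b ∈ univ.erase a, ∑ x,
        sm i j x a b * lam x * cc x * cc (TT i j a (TT i j b x)) *
          (f x * (f (TT i j a (TT i j b x)) - f x)) = ∑ x, ∑ b ∈ univ.erase a,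
        sm i j x a b * lam x * cc x * cc (TT i j a (TT i j b x)) *
          (f x * (f (TT i j a (TT i j b x)) - f x)) := fun a => Finset.sum_comm
    rw [Finset.sum_congr rfl fun a _ => this a, Finset.sum_comm, Finset.sum_filter]
    refine Finset.sum_congr rfl fun x _ => ?_
    split_ifs with hx
    · have hl : lam x = 1 := by unfold lam; exact if_pos hx
      rw [pi_eq, show cc x * cc x * f x * opM i j f x = (cc x * f x) * (cc x * opM i j f x) by ring,
        opM_eq hij f x hx, Finset.mul_sum]
      refine Finset.sum_congr rfl fun a _ => ?_
      rw [Finset.mul_sum]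
      refine Finset.sum_congr rfl fun b _ => ?_
      rw [hl]; ring
    · have hl : lam x = 0 := by unfold lam; exact if_neg hx
      simp [hl]
  rw [e]
  refine Finset.sum_nonpos fun a _ => Finset.sum_nonpos fun b hb => ?_
  have h := Finset.ne_of_mem_erase hb
  set F : (Fin (2 * n) → Fin N) → ℝ := fun x =>
    sm i j x a b * lam x * cc x * cc (TT i j a (TT i j b x)) *
          (f x * (f (TT i j a (TT i j b x)) - f x)) with hF
  have h2 : ∑ x, F x = ∑ x, F (TT i j a (TT i j b x)) := by
    rw [sum_TT i j b (fun x => F (TT i j a x)), sum_TT i j a F]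
  have h3 : ∑ x, F x + ∑ x, F (TT i j a (TT i j b x)) ≤ 0 := by
    rw [← Finset.sum_add_distrib]
    refine Finset.sum_nonpos fun x _ => ?_
    have i1 : TT i j a (TT i j b (TT i j a (TT i j b x))) = x := by
      rw [TT_comm i j b a, TT_invol, TT_invol]
    have i2 : sm i j (TT i j a (TT i j b x)) a b = sm i j x a b := by
      unfold sm
      rw [ind_TT_self, ind_TT_self', ind_TT_ne _ _ _ h, ind_TT_ne _ _ _ h, ind_TT_self,
        ind_TT_self', ind_TT_ne _ _ _ h.symm, ind_TT_ne _ _ _ h.symm]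
      ring
    simp only [hF, i1, i2, sm_lam hij h]
    have p1 := cc_pos x
    have p2 := cc_pos (TT i j a (TT i j b x))
    have p3 := sm_nonneg i j a b x
    have p4 := lam_nonneg x
    have p5 : 0 ≤ sm i j x a b * lam x * cc x * cc (TT i j a (TT i j b x)) *
      (f (TT i j a (TT i j b x)) - f x) ^ 2 := by positivity
    nlinarith [p5]
  linarith

end helpers

/-- Each generator `𝓛_{ij}` of the colored eigenvector moment flow is negative
semidefinite in `L²(π)` on `Λⁿ`. -/
theorem opL_negative_semidefinite {N n : ℕ} (hN : 2 ≤ N) (hn : 1 ≤ n)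
    (i j : Fin N) (hij : i < j) (f : (Fin (2 * n) → Fin N) → ℝ) :
    ∑ x ∈ Finset.univ.filter (fun x : Fin (2 * n) → Fin N => ∀ k, Even (cnt x k)),
        (piMeas x : ℝ) * f x * opL i j f x ≤ 0 := by
  have h1 := part1 hij.ne f
  have h2 := part2 hij.ne f
  have h3 : ∑ x ∈ Finset.univ.filter (fun x : Fin (2 * n) → Fin N => ∀ k, Even (cnt x k)),
        (piMeas x : ℝ) * f x * opL i j f x
      = (∑ x ∈ Finset.univ.filter (fun x : Fin (2 * n) → Fin N => ∀ k, Even (cnt x k)),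
          (piMeas x : ℝ) * f x * opM i j f x
        + ∑ x ∈ Finset.univ.filter (fun x : Fin (2 * n) → Fin N => ∀ k, Even (cnt x k)),
          (piMeas x : ℝ) * f x * (opM i j f x - 2 * opE i j f x)) / 2 := by
    rw [← Finset.sum_add_distrib, Finset.sum_div]
    refine Finset.sum_congr rfl fun x _ => ?_
    unfold opL
    ring
  rw [h3]
  linarith
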